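/- Under hypotheses (H1), (H2) and (H3), the boundary-input system is ISS with respect to all admissible inputs if and only if it is ISS with respect to inputs that are constant in time and space (i.e. inputs u with u(t,z) = c for some c ∈ ℝ and all (t,z) ∈ ℝ≥0 × ∂G). -/

import Mathlib

open Filter Set MeasureTheory ENNReal

noncomputable section

/-- `γ` is of class `K`: continuous, strictly increasing on `[0,∞)` with `γ(0) = 0`. -/
def ClassK (γ : ℝ → ℝ) : Prop :=
  ContinuousOn γ (Ici 0) ∧ StrictMonoOn γ (Ici 0) ∧ γ 0 = 0

/-- `γ` is of class `K∞`: of class `K` and unbounded. -/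
def ClassKInf (γ : ℝ → ℝ) : Prop :=
  ClassK γ ∧ Tendsto γ atTop atTop

/-- `β` is of class `KL`. -/
def ClassKL (β : ℝ → ℝ → ℝ) : Prop :=
  ContinuousOn (fun q : ℝ × ℝ => β q.1 q.2) (Ici 0 ×ˢ Ici 0) ∧
  (∀ t ≥ (0:ℝ), ClassK fun r => β r t) ∧
  (∀ r > (0:ℝ), StrictAntiOn (fun t => β r t) (Ici 0) ∧
    Tendsto (fun t => β r t) atTop (nhds 0))

/-- The `i`-th coordinate direction in `ℝⁿ`. -/
def edir (n : ℕ) (i : Fin n) : EuclideanSpace ℝ (Fin n) := EuclideanSpace.single i (1:ℝ)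

/-- Second partial derivative `∂²u/(∂z_i ∂z_j)` at `z`. -/
def pder2 {n : ℕ} (u : EuclideanSpace ℝ (Fin n) → ℝ) (z : EuclideanSpace ℝ (Fin n))
    (i j : Fin n) : ℝ :=
  fderiv ℝ (fun w => fderiv ℝ u w (edir n i)) z (edir n j)

/-- Gradient `∇u(z)`, viewed as a vector of `ℝⁿ`. -/
def grad {n : ℕ} (u : EuclideanSpace ℝ (Fin n) → ℝ) (z : EuclideanSpace ℝ (Fin n)) :
    EuclideanSpace ℝ (Fin n) :=
  (WithLp.equiv 2 (Fin n → ℝ)).symm fun i => fderiv ℝ u z (edir n i)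

/-- The parabolic operator
`(Lx)(t,z) = ∂x/∂t(t,z) − Σ_{i,j} a_{ij}(z) ∂²x/(∂z_i∂z_j)(t,z) − f(z, x(t,z), ∇_z x(t,z))`. -/
def Lop {n : ℕ} (a : Fin n → Fin n → EuclideanSpace ℝ (Fin n) → ℝ)
    (f : EuclideanSpace ℝ (Fin n) → ℝ → EuclideanSpace ℝ (Fin n) → ℝ)
    (x : ℝ → EuclideanSpace ℝ (Fin n) → ℝ) (t : ℝ) (z : EuclideanSpace ℝ (Fin n)) : ℝ :=
  deriv (fun s => x s z) t
    - ∑ i, ∑ j, a i j z * pder2 (x t) z i j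
    - f z (x t z) (grad (x t) z)

/-- `x ∈ C^{1,2}(D)`: once continuously differentiable in `t` and twice continuously
differentiable in `z` on `D`. -/
def C12On {n : ℕ} (x : ℝ → EuclideanSpace ℝ (Fin n) → ℝ)
    (D : Set (ℝ × EuclideanSpace ℝ (Fin n))) : Prop :=
  (∀ p ∈ D, DifferentiableAt ℝ (fun s => x s p.2) p.1) ∧
  ContinuousOn (fun p : ℝ × EuclideanSpace ℝ (Fin n) => deriv (fun s => x s p.2) p.1) D ∧
  (∀ p ∈ D, DifferentiableAt ℝ (x p.1) p.2) ∧
  (∀ p ∈ D, DifferentiableAt ℝ (fun w => fderiv ℝ (x p.1) w) p.2) ∧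
  ContinuousOn
    (fun p : ℝ × EuclideanSpace ℝ (Fin n) => fderiv ℝ (fun w => fderiv ℝ (x p.1) w) p.2) D

/-- `L` is uniformly parabolic: `Σ_{i,j} a_{ij}(z) ξ_i ξ_j ≥ K|ξ|²` on `closure G`. -/
def UniformlyParabolic {n : ℕ} (G : Set (EuclideanSpace ℝ (Fin n)))
    (a : Fin n → Fin n → EuclideanSpace ℝ (Fin n) → ℝ) : Prop :=
  ∃ K > (0:ℝ), ∀ z ∈ closure G, ∀ ξ : EuclideanSpace ℝ (Fin n),
    K * ‖ξ‖ ^ 2 ≤ ∑ i, ∑ j, a i j z * ξ i * ξ j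

/-- The one-sided Lipschitz condition of Hypothesis (H2). -/
def OneSidedLip {n : ℕ} (G : Set (EuclideanSpace ℝ (Fin n)))
    (f : EuclideanSpace ℝ (Fin n) → ℝ → EuclideanSpace ℝ (Fin n) → ℝ) : Prop :=
  ∀ W : Set ℝ, Bornology.IsBounded W → ∃ k > (0:ℝ),
    ∀ w₁ ∈ W, ∀ w₂ ∈ W, w₂ < w₁ → ∀ z ∈ G, ∀ ξ : EuclideanSpace ℝ (Fin n),
      f z w₁ ξ - f z w₂ ξ < k * (w₁ - w₂)

/-- A boundary input: a bounded continuous function on `ℝ≥0 × ∂G`. -/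
def IsBdryInput {n : ℕ} (G : Set (EuclideanSpace ℝ (Fin n)))
    (u : ℝ → EuclideanSpace ℝ (Fin n) → ℝ) : Prop :=
  ContinuousOn (fun q : ℝ × EuclideanSpace ℝ (Fin n) => u q.1 q.2) (Ici 0 ×ˢ frontier G) ∧
  ∃ C : ℝ, ∀ t ≥ (0:ℝ), ∀ z ∈ frontier G, |u t z| ≤ C

/-- The `L^p(G)` norm of a state. -/
def Xnorm {n : ℕ} (G : Set (EuclideanSpace ℝ (Fin n))) (p : ℝ≥0∞)
    (x : EuclideanSpace ℝ (Fin n) → ℝ) : ℝ :=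
  (eLpNorm x p (volume.restrict G)).toReal

/-- The sup-norm `sup_{t ≥ 0, z ∈ ∂G} |u(t,z)|` of a boundary input. -/
def bdryNorm {n : ℕ} (G : Set (EuclideanSpace ℝ (Fin n)))
    (u : ℝ → EuclideanSpace ℝ (Fin n) → ℝ) : ℝ :=
  sSup ((fun q : ℝ × EuclideanSpace ℝ (Fin n) => |u q.1 q.2|) '' (Ici 0 ×ˢ frontier G))

/-- Inputs that are constant in time and space on the boundary. -/
def ConstInputs {n : ℕ} (G : Set (EuclideanSpace ℝ (Fin n))) :
    Set (ℝ → EuclideanSpace ℝ (Fin n) → ℝ) :=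
  {u | ∃ c : ℝ, ∀ t ≥ (0:ℝ), ∀ z ∈ frontier G, u t z = c}

/-- ISS of the boundary-input system with respect to inputs in `S`. -/
def BdryISSwrt {n : ℕ} (G : Set (EuclideanSpace ℝ (Fin n))) (p : ℝ≥0∞)
    (X : Set (EuclideanSpace ℝ (Fin n) → ℝ))
    (A : (EuclideanSpace ℝ (Fin n) → ℝ) → Set (ℝ → EuclideanSpace ℝ (Fin n) → ℝ))
    (φ : (EuclideanSpace ℝ (Fin n) → ℝ) → (ℝ → EuclideanSpace ℝ (Fin n) → ℝ) →
      ℝ → EuclideanSpace ℝ (Fin n) → ℝ)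
    (S : Set (ℝ → EuclideanSpace ℝ (Fin n) → ℝ)) : Prop :=
  ∃ β γ : _, ClassKL β ∧ ClassK γ ∧
    ∀ x₀ ∈ X, ∀ u ∈ A x₀ ∩ S, ∀ t ≥ (0:ℝ),
      Xnorm G p (φ x₀ u t) ≤ β (Xnorm G p x₀) t + γ (bdryNorm G u)

/-- exp-ISS of the boundary-input system with respect to inputs in `S`. -/
def BdryExpISSwrt {n : ℕ} (G : Set (EuclideanSpace ℝ (Fin n))) (p : ℝ≥0∞)
    (X : Set (EuclideanSpace ℝ (Fin n) → ℝ))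
    (A : (EuclideanSpace ℝ (Fin n) → ℝ) → Set (ℝ → EuclideanSpace ℝ (Fin n) → ℝ))
    (φ : (EuclideanSpace ℝ (Fin n) → ℝ) → (ℝ → EuclideanSpace ℝ (Fin n) → ℝ) →
      ℝ → EuclideanSpace ℝ (Fin n) → ℝ)
    (S : Set (ℝ → EuclideanSpace ℝ (Fin n) → ℝ)) : Prop :=
  ∃ M > (0:ℝ), ∃ a > (0:ℝ), ∃ γ : ℝ → ℝ, ClassKInf γ ∧
    ∀ x₀ ∈ X, ∀ u ∈ A x₀ ∩ S, ∀ t ≥ (0:ℝ),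
      Xnorm G p (φ x₀ u t) ≤ M * Real.exp (-a * t) * Xnorm G p x₀ + γ (bdryNorm G u)

open scoped MatrixOrder Matrix in
lemma psd_fact {n : ℕ} {A : Matrix (Fin n) (Fin n) ℝ} (h : A.PosSemidef) :
    ∃ B : Matrix (Fin n) (Fin n) ℝ, A = Bᴴ * B := by
  obtain ⟨B, hB⟩ := CStarAlgebra.nonneg_iff_eq_star_mul_self.mp h.nonneg
  exact ⟨B, hB⟩


lemma trace_nonpos {n : ℕ} (a H : Fin n → Fin n → ℝ)
    (ha : ∀ ξ : EuclideanSpace ℝ (Fin n), 0 ≤ ∑ i, ∑ j, a i j * ξ i * ξ j)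
    (hs : ∀ i j, H i j = H j i)
    (hH : ∀ v : Fin n → ℝ, ∑ i, ∑ j, H i j * v i * v j ≤ 0) :
    ∑ i, ∑ j, a i j * H i j ≤ 0 := by
  have hpsd : (Matrix.of fun i j => - H i j).PosSemidef := by
    refine Matrix.PosSemidef.of_dotProduct_mulVec_nonneg ?_ ?_
    · ext i j; simp [hs i j]
    · intro v
      have := hH v
      have e : star v ⬝ᵥ (Matrix.of fun i j => - H i j).mulVec v
          = - ∑ i, ∑ j, H i j * v i * v j := by
        simp only [dotProduct, Matrix.mulVec, Matrix.of_apply, Finset.mul_sum,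
          ← Finset.sum_neg_distrib]
        refine Finset.sum_congr rfl fun i _ => Finset.sum_congr rfl fun j _ => ?_
        simp; ring
      rw [e]; linarith
  obtain ⟨B, hB⟩ := psd_fact hpsd
  have hij : ∀ i j, H i j = - ∑ k, B k i * B k j := by
    intro i j
    have := congrFun (congrFun hB i) j
    simp [Matrix.mul_apply] at this
    linarith
  have : ∑ i, ∑ j, a i j * H i j = - ∑ k, ∑ i, ∑ j, a i j * B k i * B k j := by
    rw [Finset.sum_comm, ← Finset.sum_neg_distrib]
    simp_rw [hij]
    rw [Finset.sum_comm]
    have : ∀ i, ∑ k, ∑ j, a i j * B k i * B k j = ∑ j, a i j * ∑ k, B k i * B k j := by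
      intro i
      rw [Finset.sum_comm]
      refine Finset.sum_congr rfl fun j _ => ?_
      rw [Finset.mul_sum]
      exact Finset.sum_congr rfl fun k _ => by ring
    simp_rw [Finset.sum_neg_distrib]
    rw [Finset.sum_comm (γ := Fin n) (f := fun k i => ∑ j, a i j * B k i * B k j)]
    simp_rw [this]
    simp
  rw [this]
  have : 0 ≤ ∑ k, ∑ i, ∑ j, a i j * B k i * B k j :=
    Finset.sum_nonneg fun k _ => by simpa using ha (WithLp.toLp 2 (B k))
  linarith

lemma second_test (g g' : ℝ → ℝ) (c : ℝ)
    (h1 : ∀ᶠ s in nhds (0:ℝ), HasDerivAt g (g' s) s) (h2 : HasDerivAt g' c 0)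
    (hm : IsLocalMax g 0) : c ≤ 0 := by
  by_contra hc
  push Not at hc
  have hev : deriv g =ᶠ[nhds 0] g' := h1.mono fun s hs => hs.deriv
  have hdd : deriv (deriv g) 0 = c := by rw [hev.deriv_eq]; exact h2.deriv
  have hmin : IsLocalMin g 0 :=
    isLocalMin_of_deriv_deriv_pos (by rw [hdd]; exact hc) hm.deriv_eq_zero
      h1.self_of_nhds.continuousAt
  have hcst : g =ᶠ[nhds 0] fun _ => g 0 := by
    filter_upwards [hm, hmin] with s h3 h4 using le_antisymm h3 h4
  have : deriv g =ᶠ[nhds 0] fun _ => 0 := by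
    have := hcst.deriv
    simpa using this
  have h0 := this.deriv_eq
  simp at h0
  linarith

lemma left_deriv_nonneg (w : ℝ → ℝ) (c T t : ℝ) (ht : 0 < t) (htT : t ≤ T)
    (h : HasDerivAt w c t) (hm : ∀ s ∈ Icc 0 T, w s ≤ w t) : 0 ≤ c := by
  have h1 := (hasDerivWithinAt_iff_tendsto_slope' (s := Iio t) (x := t) (by simp)).1
    h.hasDerivWithinAt
  refine ge_of_tendsto h1 ?_
  filter_upwards [Ioo_mem_nhdsLT ht] with s hs
  rw [slope_def_field]
  have := hm s ⟨hs.1.le, hs.2.le.trans htT⟩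
  exact div_nonneg_of_nonpos (by linarith) (by linarith [hs.2])

/-- spatial part at an interior maximum -/
lemma space_max {n : ℕ} (G : Set (EuclideanSpace ℝ (Fin n))) (hG : IsOpen G)
    (a : Fin n → Fin n → ℝ)
    (ha : ∀ ξ : EuclideanSpace ℝ (Fin n), 0 ≤ ∑ i, ∑ j, a i j * ξ i * ξ j)
    (u v : EuclideanSpace ℝ (Fin n) → ℝ)
    (hu : ∀ z ∈ G, DifferentiableAt ℝ u z) (hv : ∀ z ∈ G, DifferentiableAt ℝ v z)
    (z : EuclideanSpace ℝ (Fin n)) (hz : z ∈ G)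
    (hu2 : DifferentiableAt ℝ (fun w => fderiv ℝ u w) z)
    (hv2 : DifferentiableAt ℝ (fun w => fderiv ℝ v w) z)
    (hm : ∀ w ∈ G, u w - v w ≤ u z - v z) :
    grad u z = grad v z ∧
      ∑ i, ∑ j, a i j * pder2 u z i j ≤ ∑ i, ∑ j, a i j * pder2 v z i j := by
  set d : EuclideanSpace ℝ (Fin n) → ℝ := fun w => u w - v w with hd
  set D : EuclideanSpace ℝ (Fin n) → (EuclideanSpace ℝ (Fin n) →L[ℝ] ℝ) :=
    fun w => fderiv ℝ u w - fderiv ℝ v w with hD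
  have hdD : ∀ w ∈ G, HasFDerivAt d (D w) w := fun w hw =>
    (hu w hw).hasFDerivAt.sub (hv w hw).hasFDerivAt
  set B := fderiv ℝ (fun w => fderiv ℝ u w) z - fderiv ℝ (fun w => fderiv ℝ v w) z with hB
  have hDB : HasFDerivAt D B z := hu2.hasFDerivAt.sub hv2.hasFDerivAt
  have hGn : ∀ᶠ w in nhds z, w ∈ G := hG.mem_nhds hz
  have hloc : IsLocalMax d z := hGn.mono hm
  have hsym : ∀ p q, B p q = B q p := fun p q =>
    second_derivative_symmetric_of_eventually (hGn.mono hdD) hDB p q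
  have hD0 : D z = 0 := hloc.hasFDerivAt_eq_zero (hdD z hz)
  have hneg : ∀ p, B p p ≤ 0 := by
    intro p
    have hline : ∀ s : ℝ, HasDerivAt (fun s : ℝ => z + s • p) p s := by
      intro s
      simpa using ((hasDerivAt_id s).smul_const p).const_add z
    have hct : Tendsto (fun s : ℝ => z + s • p) (nhds 0) (nhds z) := by
      have := (hline 0).continuousAt.tendsto
      simpa using this
    refine second_test (fun s => d (z + s • p)) (fun s => D (z + s • p) p) _ ?_ ?_ ?_
    · filter_upwards [hct hGn] with s hs
      exact (hdD _ hs).comp_hasDerivAt s (hline s)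
    · have h1 : HasFDerivAt D B (z + (0:ℝ) • p) := by simpa using hDB
      have h2 := h1.comp_hasDerivAt (0:ℝ) (hline 0)
      exact h2.clm_apply (hasDerivAt_const (0:ℝ) p) |>.congr_deriv (by simp)
    · have := hct.eventually hloc
      filter_upwards [this] with s hs
      simpa using hs
  have hpu : ∀ i j, pder2 u z i j = fderiv ℝ (fun w => fderiv ℝ u w) z (edir n j) (edir n i) := by
    intro i j
    have := hu2.hasFDerivAt.clm_apply (hasFDerivAt_const (edir n i) z)
    rw [pder2, this.fderiv]; simp
  have hpv : ∀ i j, pder2 v z i j = fderiv ℝ (fun w => fderiv ℝ v w) z (edir n j) (edir n i) := by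
    intro i j
    have := hv2.hasFDerivAt.clm_apply (hasFDerivAt_const (edir n i) z)
    rw [pder2, this.fderiv]; simp
  constructor
  · have : fderiv ℝ u z = fderiv ℝ v z := sub_eq_zero.1 hD0
    simp [grad, this]
  · have key := trace_nonpos a (fun i j => B (edir n j) (edir n i)) ha
      (fun i j => hsym _ _) (by
        intro w
        have := hneg (∑ i, w i • edir n i)
        simp only [map_sum, map_smul, _root_.sum_apply, _root_.smul_apply,
          smul_eq_mul] at this
        refine le_trans (le_of_eq ?_) this
        refine Finset.sum_congr rfl fun i _ => ?_
        rw [Finset.mul_sum]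
        refine Finset.sum_congr rfl fun j _ => ?_
        ring)
    have : ∑ i, ∑ j, a i j * B (edir n j) (edir n i) =
        ∑ i, ∑ j, a i j * pder2 u z i j - ∑ i, ∑ j, a i j * pder2 v z i j := by
      simp_rw [hpu, hpv, ← Finset.sum_sub_distrib, ← mul_sub]
      rfl
    linarith

lemma comparison {n : ℕ} (G : Set (EuclideanSpace ℝ (Fin n)))
    (hGopen : IsOpen G) (hGbdd : Bornology.IsBounded G)
    (a : Fin n → Fin n → EuclideanSpace ℝ (Fin n) → ℝ)
    (hpar : UniformlyParabolic G a)
    (f : EuclideanSpace ℝ (Fin n) → ℝ → EuclideanSpace ℝ (Fin n) → ℝ)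
    (hlip : OneSidedLip G f)
    (x y : ℝ → EuclideanSpace ℝ (Fin n) → ℝ)
    (hxc : ContinuousOn (fun q : ℝ × EuclideanSpace ℝ (Fin n) => x q.1 q.2) (Ici 0 ×ˢ closure G))
    (hyc : ContinuousOn (fun q : ℝ × EuclideanSpace ℝ (Fin n) => y q.1 q.2) (Ici 0 ×ˢ closure G))
    (hx : C12On x (Ioi 0 ×ˢ G)) (hy : C12On y (Ioi 0 ×ˢ G))
    (hLx : ∀ q ∈ (Ioi (0:ℝ)) ×ˢ G, Lop a f x q.1 q.2 = 0)
    (hLy : ∀ q ∈ (Ioi (0:ℝ)) ×ˢ G, Lop a f y q.1 q.2 = 0)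
    (h0 : ∀ z ∈ G, x 0 z ≤ y 0 z)
    (hb : ∀ t ≥ (0:ℝ), ∀ z ∈ frontier G, x t z ≤ y t z) :
    ∀ t ≥ (0:ℝ), ∀ z ∈ G, x t z ≤ y t z := by
  intro T hT z1 hz1
  by_contra hcon
  push Not at hcon
  have hcomp : IsCompact (Icc 0 T ×ˢ closure G) := isCompact_Icc.prod hGbdd.isCompact_closure
  have hsub : Icc 0 T ×ˢ closure G ⊆ Ici 0 ×ˢ closure G :=
    prod_mono Icc_subset_Ici_self subset_rfl
  have hx' := hxc.mono hsub
  have hy' := hyc.mono hsub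
  obtain ⟨k, hk, hkf⟩ := hlip _ ((hcomp.image_of_continuousOn hx').isBounded.union
    (hcomp.image_of_continuousOn hy').isBounded)
  have hmem1 : (T, z1) ∈ Icc 0 T ×ˢ closure G := ⟨⟨hT, le_rfl⟩, subset_closure hz1⟩
  obtain ⟨⟨t0, z0⟩, hq0, hmax⟩ := hcomp.exists_isMaxOn
    (f := fun q : ℝ × EuclideanSpace ℝ (Fin n) => Real.exp (-k * q.1) * (x q.1 q.2 - y q.1 q.2))
    ⟨_, hmem1⟩ (ContinuousOn.mul (by fun_prop) (hx'.sub hy'))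
  have hmax : ∀ s ∈ Icc 0 T, ∀ w ∈ closure G, Real.exp (-k * s) * (x s w - y s w) ≤
      Real.exp (-k * t0) * (x t0 z0 - y t0 z0) := fun s hs w hw =>
    hmax (show (s, w) ∈ Icc 0 T ×ˢ closure G from ⟨hs, hw⟩)
  have hpos : 0 < x t0 z0 - y t0 z0 := by
    have h1 := hmax T ⟨hT, le_rfl⟩ z1 (subset_closure hz1)
    have h2 : 0 < Real.exp (-k * T) * (x T z1 - y T z1) :=
      mul_pos (Real.exp_pos _) (by linarith)
    exact (mul_pos_iff_of_pos_left (Real.exp_pos _)).1 (h2.trans_le h1)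
  obtain ⟨⟨ht0, ht0T⟩, hz0⟩ := hq0
  simp only at ht0 ht0T hz0
  have hz0G : z0 ∈ G := by
    by_contra h
    have : z0 ∈ frontier G := ⟨hz0, by rwa [hGopen.interior_eq]⟩
    linarith [hb t0 ht0 z0 this]
  have ht0' : 0 < t0 := by
    rcases ht0.lt_or_eq with h | h
    · exact h
    · subst h
      linarith [h0 z0 hz0G]
  have hqm : (t0, z0) ∈ Ioi (0:ℝ) ×ˢ G := ⟨ht0', hz0G⟩
  obtain ⟨K, hK, hKa⟩ := hpar
  obtain ⟨hgr, hsec⟩ := space_max G hGopen (fun i j => a i j z0)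
    (fun ξ => le_trans (by positivity) (hKa z0 hz0 ξ)) (x t0) (y t0)
    (fun z hz => hx.2.2.1 (t0, z) ⟨ht0', hz⟩) (fun z hz => hy.2.2.1 (t0, z) ⟨ht0', hz⟩) z0 hz0G
    (hx.2.2.2.1 _ hqm) (hy.2.2.2.1 _ hqm)
    (fun w hw => by
      have := hmax t0 ⟨ht0, ht0T⟩ w (subset_closure hw)
      exact le_of_mul_le_mul_left this (Real.exp_pos _))
  have hdx := (hx.1 _ hqm).hasDerivAt
  have hdy := (hy.1 _ hqm).hasDerivAt
  simp only at hdx hdy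
  have hde : HasDerivAt (fun s => Real.exp (-k * s)) (Real.exp (-k * t0) * (-k * 1)) t0 :=
    ((hasDerivAt_id t0).const_mul (-k)).exp
  have hd := left_deriv_nonneg _ _ T t0 ht0' ht0T (hde.mul (hdx.sub hdy))
    (fun s hs => hmax s hs z0 hz0)
  have hd2 : 0 ≤ Real.exp (-k * t0) * ((deriv (fun s => x s z0) t0 - deriv (fun s => y s z0) t0)
      - k * (x t0 z0 - y t0 z0)) := by
    refine hd.trans (le_of_eq ?_)
    simp only [Pi.sub_apply]
    ring
  have hd3 := (mul_nonneg_iff_of_pos_left (Real.exp_pos _)).1 hd2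
  have e1 := hLx _ hqm
  have e2 := hLy _ hqm
  simp only [Lop] at e1 e2
  rw [hgr] at e1
  have hm0 : (t0, z0) ∈ Icc 0 T ×ˢ closure G := ⟨⟨ht0, ht0T⟩, hz0⟩
  have := hkf (x t0 z0) (Or.inl ⟨_, hm0, rfl⟩) (y t0 z0) (Or.inr ⟨_, hm0, rfl⟩) (by linarith)
    z0 hz0G (grad (y t0) z0)
  linarith

lemma memLp_of_cont {n : ℕ} {G : Set (EuclideanSpace ℝ (Fin n))} (hGopen : IsOpen G)
    (hGbdd : Bornology.IsBounded G) (p : ℝ≥0∞) {x : EuclideanSpace ℝ (Fin n) → ℝ}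
    (hx : ContinuousOn x (closure G)) : MemLp x p (volume.restrict G) := by
  have : IsFiniteMeasure (volume.restrict G) :=
    ⟨by rw [Measure.restrict_apply_univ]; exact hGbdd.measure_lt_top⟩
  obtain ⟨C, hC⟩ := hGbdd.isCompact_closure.exists_bound_of_continuousOn hx
  refine MemLp.of_bound ((hx.mono subset_closure).aestronglyMeasurable hGopen.measurableSet) C ?_
  filter_upwards [ae_restrict_mem hGopen.measurableSet] with z hz using hC z (subset_closure hz)

lemma Xnorm_le_add {n : ℕ} {G : Set (EuclideanSpace ℝ (Fin n))} (hGopen : IsOpen G)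
    (hGbdd : Bornology.IsBounded G) (p : ℝ≥0∞) (hp : 1 ≤ p)
    {x y w : EuclideanSpace ℝ (Fin n) → ℝ}
    (hy : ContinuousOn y (closure G)) (hw : ContinuousOn w (closure G))
    (h : ∀ z ∈ G, |x z| ≤ |y z| + |w z|) : Xnorm G p x ≤ Xnorm G p y + Xnorm G p w := by
  have hyL := memLp_of_cont hGopen hGbdd p hy
  have hwL := memLp_of_cont hGopen hGbdd p hw
  unfold Xnorm
  rw [← ENNReal.toReal_add hyL.2.ne hwL.2.ne]
  refine ENNReal.toReal_mono (ENNReal.add_ne_top.2 ⟨hyL.2.ne, hwL.2.ne⟩) ?_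
  calc eLpNorm x p (volume.restrict G)
      ≤ eLpNorm ((fun z => ‖y z‖) + (fun z => ‖w z‖)) p (volume.restrict G) := by
        refine eLpNorm_mono_ae_real ?_
        filter_upwards [ae_restrict_mem hGopen.measurableSet] with z hz using h z hz
    _ ≤ _ := by
        refine (eLpNorm_add_le hyL.1.norm hwL.1.norm hp).trans ?_
        rw [eLpNorm_norm, eLpNorm_norm]

lemma Xnorm_const {n : ℕ} (G : Set (EuclideanSpace ℝ (Fin n))) (p : ℝ≥0∞) (s : ℝ) (hs : 0 ≤ s) :
    Xnorm G p (fun _ => s) = s * Xnorm G p (fun _ => 1) := by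
  have := eLpNorm_const_smul (p := p) (μ := volume.restrict G) s
    (fun _ : EuclideanSpace ℝ (Fin n) => (1:ℝ))
  unfold Xnorm
  have e : (s • fun _ : EuclideanSpace ℝ (Fin n) => (1:ℝ)) = fun _ => s := by ext; simp
  rw [e] at this
  rw [this, ENNReal.toReal_mul]
  simp [abs_of_nonneg hs]

lemma KL_double {β : ℝ → ℝ → ℝ} (h : ClassKL β) : ClassKL fun r t => 2 * β (2 * r) t := by
  obtain ⟨h1, h2, h3⟩ := h
  have hK : ∀ t ≥ (0:ℝ), ClassK fun r => 2 * β (2 * r) t := by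
    intro t ht
    obtain ⟨c1, c2, c3⟩ := h2 t ht
    refine ⟨?_, ?_, ?_⟩
    · refine ContinuousOn.mul continuousOn_const (c1.comp (by fun_prop) ?_)
      intro r hr
      simp only [mem_Ici] at *
      linarith
    · intro r hr s hs hrs
      simp only [mem_Ici] at hr hs
      have := c2 (show 2 * r ∈ Ici (0:ℝ) by simp only [mem_Ici]; linarith)
        (show 2 * s ∈ Ici (0:ℝ) by simp only [mem_Ici]; linarith) (by linarith)
      simp only at this ⊢
      linarith
    · simpa using c3
  refine ⟨?_, hK, ?_⟩
  · refine ContinuousOn.mul continuousOn_const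
      (h1.comp (f := fun q : ℝ × ℝ => (2 * q.1, q.2)) (by fun_prop) ?_)
    rintro ⟨r, t⟩ ⟨hr, ht⟩
    simp only [mem_Ici] at hr ht
    exact ⟨by simp only [mem_Ici]; linarith, ht⟩
  · intro r hr
    obtain ⟨c1, c2⟩ := h3 (2 * r) (by linarith)
    refine ⟨fun s hs t ht hst => ?_, ?_⟩
    · have := c1 hs ht hst
      simp only at this ⊢
      linarith
    · simpa using c2.const_mul 2

lemma K_new {β : ℝ → ℝ → ℝ} {γ : ℝ → ℝ} (h : ClassKL β) (hγ : ClassK γ) {C : ℝ} (hC : 0 < C) :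
    ClassK fun s => 2 * (β (2 * (C * s)) 0 + γ s) := by
  obtain ⟨c1, c2, c3⟩ := h.2.1 0 le_rfl
  obtain ⟨g1, g2, g3⟩ := hγ
  refine ⟨?_, ?_, ?_⟩
  · refine ContinuousOn.mul continuousOn_const (ContinuousOn.add (c1.comp (by fun_prop) ?_) g1)
    intro r hr
    simp only [mem_Ici] at *
    positivity
  · intro r hr s hs hrs
    have hr' : 0 ≤ r := hr
    have hs' : 0 ≤ s := hs
    have h1 := c2 (show 2 * (C * r) ∈ Ici (0:ℝ) by simp only [mem_Ici]; positivity)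
      (show 2 * (C * s) ∈ Ici (0:ℝ) by simp only [mem_Ici]; positivity)
      (by have := mul_lt_mul_of_pos_left hrs hC; linarith)
    have h2 := g2 hr hs hrs
    simp only at h1 ⊢
    linarith
  · simp only [mul_zero]
    simp only at c3
    rw [c3, g3]; simp

lemma KL_split {β : ℝ → ℝ → ℝ} (h : ClassKL β) {q r s t : ℝ} (hq : 0 ≤ q) (hr : 0 ≤ r) (hs : 0 ≤ s)
    (ht : 0 ≤ t) (hqrs : q ≤ r + s) : β q t ≤ β (2 * r) t + β (2 * s) 0 := by
  have hm : ∀ t ≥ (0:ℝ), ∀ a b : ℝ, 0 ≤ a → a ≤ b → β a t ≤ β b t := by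
    intro t ht a b ha hab
    exact (h.2.1 t ht).2.1.monotoneOn (show a ∈ Ici (0:ℝ) from ha)
      (show b ∈ Ici (0:ℝ) from ha.trans hab) hab
  have hz : ∀ t ≥ (0:ℝ), β 0 t = 0 := fun t ht => (h.2.1 t ht).2.2
  have hn : ∀ t ≥ (0:ℝ), ∀ b : ℝ, 0 ≤ b → 0 ≤ β b t := fun t ht b hb => by
    have := hm t ht 0 b le_rfl hb
    rwa [hz t ht] at this
  have hanti : ∀ b ≥ (0:ℝ), β b t ≤ β b 0 := by
    intro b hb
    rcases hb.lt_or_eq with h' | h'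
    · exact (h.2.2 b h').1.antitoneOn (show (0:ℝ) ∈ Ici (0:ℝ) from self_mem_Ici)
        (show t ∈ Ici (0:ℝ) from ht) ht
    · rw [← h', hz t ht, hz 0 le_rfl]
  rcases le_total r s with hle | hle
  · have h1 := hm t ht q (2 * s) hq (by linarith)
    have h2 := hanti (2 * s) (by linarith)
    have h3 := hn t ht (2 * r) (by linarith)
    linarith
  · have h1 := hm t ht q (2 * r) hq (by linarith)
    have h3 := hn 0 le_rfl (2 * s) (by linarith)
    linarith

lemma exists_delta {n : ℕ} {G : Set (EuclideanSpace ℝ (Fin n))}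
    (hGbdd : Bornology.IsBounded G) (hfr : (frontier G).Nonempty)
    {x : EuclideanSpace ℝ (Fin n) → ℝ} (hx : ContinuousOn x (closure G)) {s : ℝ}
    (hs : ∀ z ∈ frontier G, |x z| < s) :
    ∃ δ > (0:ℝ), ∀ z ∈ closure G, Metric.infDist z (frontier G) < δ → |x z| ≤ s := by
  set S : Set (EuclideanSpace ℝ (Fin n)) := closure G ∩ (fun z => |x z|) ⁻¹' Ici s with hS
  have hSc : IsCompact S := by
    refine hGbdd.isCompact_closure.of_isClosed_subset ?_ inter_subset_left
    exact (hx.abs).preimage_isClosed_of_isClosed isClosed_closure isClosed_Ici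
  rcases S.eq_empty_or_nonempty with he | hne
  · refine ⟨1, one_pos, fun z hz _ => ?_⟩
    by_contra hcon
    push Not at hcon
    have : z ∈ S := ⟨hz, hcon.le⟩
    rw [he] at this
    exact this
  · obtain ⟨z0, hz0, hmin⟩ := hSc.exists_isMinOn hne
      (Metric.continuous_infDist_pt (frontier G)).continuousOn
    have hz0f : z0 ∉ frontier G := fun h => by
      have h1 := hs z0 h
      have h2 : s ≤ |x z0| := hz0.2
      linarith
    refine ⟨_, (isClosed_frontier.notMem_iff_infDist_pos hfr).1 hz0f, fun z hz hd => ?_⟩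
    by_contra hcon
    push Not at hcon
    have : Metric.infDist z0 (frontier G) ≤ Metric.infDist z (frontier G) :=
      hmin (show z ∈ S from ⟨hz, hcon.le⟩)
    linarith

lemma bdryNorm_const {n : ℕ} {G : Set (EuclideanSpace ℝ (Fin n))} (hfr : (frontier G).Nonempty)
    (c : ℝ) : bdryNorm G (fun _ _ => c) = |c| := by
  have hne : (Ici (0:ℝ) ×ˢ frontier G).Nonempty := nonempty_Ici.prod hfr
  unfold bdryNorm
  rw [hne.image_const]
  simp

/-- Under (H1), (H2), (H3), the boundary-input parabolic system is ISS
with respect to all admissible inputs iff it is ISS with respect to inputs that are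
constant in time and space. -/
theorem stmt9 {n : ℕ} (G : Set (EuclideanSpace ℝ (Fin n)))
    (hGne : G.Nonempty) (hGopen : IsOpen G) (hGbdd : Bornology.IsBounded G)
    (p : ℝ≥0∞) (hp : 1 ≤ p)
    (a : Fin n → Fin n → EuclideanSpace ℝ (Fin n) → ℝ)
    (ha : ∀ i j, ContinuousOn (a i j) (closure G))
    (hpar : UniformlyParabolic G a)
    (f : EuclideanSpace ℝ (Fin n) → ℝ → EuclideanSpace ℝ (Fin n) → ℝ)
    (hf : ContinuousOn (fun q : EuclideanSpace ℝ (Fin n) × ℝ × EuclideanSpace ℝ (Fin n) =>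
      f q.1 q.2.1 q.2.2)
      ((closure G) ×ˢ (univ : Set ℝ) ×ˢ (univ : Set (EuclideanSpace ℝ (Fin n)))))
    -- Hypothesis (H2)
    (hlip : OneSidedLip G f)
    (hfdiff : ∀ z ∈ closure G,
      ContDiff ℝ 1 fun q : ℝ × EuclideanSpace ℝ (Fin n) => f z q.1 q.2)
    (X : Set (EuclideanSpace ℝ (Fin n) → ℝ))
    (A : (EuclideanSpace ℝ (Fin n) → ℝ) → Set (ℝ → EuclideanSpace ℝ (Fin n) → ℝ))
    (φ : (EuclideanSpace ℝ (Fin n) → ℝ) → (ℝ → EuclideanSpace ℝ (Fin n) → ℝ) →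
      ℝ → EuclideanSpace ℝ (Fin n) → ℝ)
    -- Hypothesis (H1): the state space
    (hXcont : ∀ x ∈ X, ContinuousOn x (closure G))
    (hXconst : ∀ c : ℝ, (fun _ => c) ∈ X)
    (hXadd : ∀ x ∈ X, ∀ y ∈ X, (fun z => x z + y z) ∈ X)
    (hXsmul : ∀ c : ℝ, ∀ x ∈ X, (fun z => c * x z) ∈ X)
    -- Hypothesis (H1): admissible inputs
    (hAne : ∀ x₀ ∈ X, (∃ c : ℝ, ∀ z ∈ frontier G, x₀ z = c) → (A x₀).Nonempty)
    (hAmem : ∀ x₀ ∈ X, ∀ u ∈ A x₀, IsBdryInput G u ∧ ∀ z ∈ frontier G, u 0 z = x₀ z)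
    (hAconst : ∀ x₀ ∈ X, ∀ c : ℝ, (∀ z ∈ frontier G, x₀ z = c) →
      ∀ u : ℝ → EuclideanSpace ℝ (Fin n) → ℝ, IsBdryInput G u →
        (∀ t ≥ (0:ℝ), ∀ z ∈ frontier G, u t z = c) → u ∈ A x₀)
    -- Hypothesis (H1): `φ` yields classical solutions with time-slices in `X`
    (hφ : ∀ x₀ ∈ X, ∀ u ∈ A x₀,
      ContinuousOn (fun q : ℝ × EuclideanSpace ℝ (Fin n) => φ x₀ u q.1 q.2)
        (Ici 0 ×ˢ closure G) ∧
      C12On (φ x₀ u) (Ioi 0 ×ˢ G) ∧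
      (∀ q ∈ (Ioi (0:ℝ)) ×ˢ G, Lop a f (φ x₀ u) q.1 q.2 = 0) ∧
      (∀ z ∈ G, φ x₀ u 0 z = x₀ z) ∧
      (∀ t ≥ (0:ℝ), ∀ z ∈ frontier G, φ x₀ u t z = u t z) ∧
      (∀ t ≥ (0:ℝ), φ x₀ u t ∈ X))
    -- Hypothesis (H3)
    (hH3 : ∀ δ > (0:ℝ), ∀ c : ℝ, ∀ x ∈ X, ∃ k : EuclideanSpace ℝ (Fin n) → ℝ,
      ContinuousOn k (closure G) ∧ (∀ z ∈ closure G, k z ∈ Icc (0:ℝ) 1) ∧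
      (∀ z ∈ frontier G, k z = 1) ∧
      (∀ z ∈ closure G, δ ≤ Metric.infDist z (frontier G) → k z = 0) ∧
      (fun z => (1 - k z) * x z + c * k z) ∈ X)
    :
    BdryISSwrt G p X A φ (univ : Set (ℝ → EuclideanSpace ℝ (Fin n) → ℝ)) ↔
      BdryISSwrt G p X A φ (ConstInputs G) := by
  refine ⟨fun ⟨β, γ, hβ, hγ, h⟩ => ⟨β, γ, hβ, hγ, fun x₀ hx₀ u hu => h x₀ hx₀ u ⟨hu.1, mem_univ _⟩⟩,
    ?_⟩
  rintro ⟨β, γ, hβ, hγ, h⟩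
  rcases (frontier G).eq_empty_or_nonempty with hfe | hfr
  · refine ⟨β, γ, hβ, hγ, fun x₀ hx₀ u hu => h x₀ hx₀ u ⟨hu.1, 0, ?_⟩⟩
    intro t _ z hz
    rw [hfe] at hz
    exact hz.elim
  have hN1 : 0 ≤ Xnorm G p (fun _ : EuclideanSpace ℝ (Fin n) => (1:ℝ)) := ENNReal.toReal_nonneg
  set C : ℝ := Xnorm G p (fun _ : EuclideanSpace ℝ (Fin n) => (1:ℝ)) + 1 with hCdef
  have hC : 0 < C := by linarith
  have hγ' := K_new hβ hγ hC
  refine ⟨_, _, KL_double hβ, hγ', ?_⟩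
  rintro x₀ hx₀ u ⟨hu, -⟩ t ht
  obtain ⟨⟨huc, Cu, hCu⟩, hu0⟩ := hAmem x₀ hx₀ u hu
  have huM : ∀ t ≥ (0:ℝ), ∀ z ∈ frontier G, |u t z| ≤ bdryNorm G u := by
    intro t ht z hz
    refine le_csSup ⟨Cu, ?_⟩ ⟨(t, z), ⟨ht, hz⟩, rfl⟩
    rintro _ ⟨q, hq, rfl⟩
    exact hCu q.1 hq.1 q.2 hq.2
  set M := bdryNorm G u with hM
  have hM0 : 0 ≤ M := by
    obtain ⟨z, hz⟩ := hfr
    exact (abs_nonneg _).trans (huM 0 le_rfl z hz)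
  obtain ⟨hφc, hφ2, hφL, hφ0, hφb, hφX⟩ := hφ x₀ hx₀ u hu
  suffices hs : ∀ s > M, Xnorm G p (φ x₀ u t) - 2 * β (2 * Xnorm G p x₀) t ≤
      2 * (β (2 * (C * s)) 0 + γ s) by
    have hcw : Tendsto (fun s => 2 * (β (2 * (C * s)) 0 + γ s)) (nhdsWithin M (Ioi M))
        (nhds (2 * (β (2 * (C * M)) 0 + γ M))) :=
      (hγ'.1 M hM0).mono_left (nhdsWithin_mono _ fun s hs => hM0.trans (le_of_lt hs))
    have := ge_of_tendsto hcw (eventually_nhdsWithin_of_forall hs)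
    linarith
  intro s hsM
  have hs0 : 0 < s := lt_of_le_of_lt hM0 hsM
  obtain ⟨δ, hδ, hxδ⟩ := exists_delta hGbdd hfr (hXcont x₀ hx₀) (s := s) (fun z hz => by
    rw [← hu0 z hz]; exact (huM 0 le_rfl z hz).trans_lt hsM)
  -- the comparison solution with boundary value `c = ± s`
  have key : ∀ c : ℝ, |c| = s → ∃ y : ℝ → EuclideanSpace ℝ (Fin n) → ℝ,
      ContinuousOn (fun q : ℝ × EuclideanSpace ℝ (Fin n) => y q.1 q.2) (Ici 0 ×ˢ closure G) ∧
      C12On y (Ioi 0 ×ˢ G) ∧ (∀ q ∈ (Ioi (0:ℝ)) ×ˢ G, Lop a f y q.1 q.2 = 0) ∧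
      (∀ t ≥ (0:ℝ), ∀ z ∈ frontier G, y t z = c) ∧ ContinuousOn (y t) (closure G) ∧
      (∀ z ∈ G, (c = s → x₀ z ≤ y 0 z) ∧ (c = -s → y 0 z ≤ x₀ z)) ∧
      Xnorm G p (y t) ≤ β (2 * Xnorm G p x₀) t + β (2 * (C * s)) 0 + γ s := by
    intro c hc
    obtain ⟨k, hkc, hk01, hk1, hk0, hkX⟩ := hH3 δ hδ c x₀ hx₀
    set x₁ : EuclideanSpace ℝ (Fin n) → ℝ := fun z => (1 - k z) * x₀ z + c * k z with hx₁
    have hv : (fun _ _ => c) ∈ A x₁ := by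
      refine hAconst x₁ hkX c ?_ _ ⟨continuousOn_const, |c|, fun _ _ _ _ => le_rfl⟩
        (fun _ _ _ _ => rfl)
      intro z hz
      simp [hx₁, hk1 z hz]
    obtain ⟨h1, h2, h3, h4, h5, h6⟩ := hφ x₁ hkX _ hv
    refine ⟨φ x₁ (fun _ _ => c), h1, h2, h3, h5, hXcont _ (h6 t ht), ?_, ?_⟩
    · intro z hz
      rw [h4 z hz]
      have hkz := hk01 z (subset_closure hz)
      rcases lt_or_ge (Metric.infDist z (frontier G)) δ with hd | hd
      · have hb := abs_le.1 (hxδ z (subset_closure hz) hd)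
        simp only [hx₁]
        constructor
        · rintro rfl
          nlinarith [mul_nonneg hkz.1 (sub_nonneg.2 hb.2)]
        · rintro rfl
          nlinarith [mul_nonneg hkz.1 (neg_le_iff_add_nonneg.1 hb.1)]
      · have := hk0 z (subset_closure hz) hd
        simp [hx₁, this]
    · have hn := h x₁ hkX _ ⟨hv, c, fun _ _ _ _ => rfl⟩ t ht
      rw [bdryNorm_const hfr, hc] at hn
      have hx1n : Xnorm G p x₁ ≤ Xnorm G p x₀ + C * s := by
        have := Xnorm_le_add (x := x₁) (w := fun _ => s) hGopen hGbdd p hp (hXcont x₀ hx₀)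
          continuousOn_const (fun z hz => by
            have hkz := hk01 z (subset_closure hz)
            simp only [hx₁]
            refine (abs_add_le _ _).trans ?_
            rw [abs_mul, abs_mul, hc, abs_of_nonneg hs0.le, abs_of_nonneg hkz.1,
              abs_of_nonneg (sub_nonneg.2 hkz.2)]
            nlinarith [mul_nonneg hkz.1 (abs_nonneg (x₀ z)), mul_nonneg hs0.le (sub_nonneg.2 hkz.2)])
        rw [Xnorm_const G p s hs0.le] at this
        rw [hCdef]
        linarith
      have := KL_split hβ (q := Xnorm G p x₁) (r := Xnorm G p x₀) (s := C * s) (t := t)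
        ENNReal.toReal_nonneg ENNReal.toReal_nonneg (by positivity) ht hx1n
      linarith
  obtain ⟨y, y1, y2, y3, y4, y5, y6, y7⟩ := key s (abs_of_pos hs0)
  obtain ⟨w, w1, w2, w3, w4, w5, w6, w7⟩ := key (-s) (by rw [abs_neg, abs_of_pos hs0])
  have hup := comparison G hGopen hGbdd a hpar f hlip _ _ hφc y1 hφ2 y2 hφL y3
    (fun z hz => by rw [hφ0 z hz]; exact (y6 z hz).1 rfl)
    (fun t ht z hz => by
      rw [hφb t ht z hz, y4 t ht z hz]; linarith [(abs_le.1 (huM t ht z hz)).2]) t ht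
  have hlo := comparison G hGopen hGbdd a hpar f hlip _ _ w1 hφc w2 hφ2 w3 hφL
    (fun z hz => by rw [hφ0 z hz]; exact (w6 z hz).2 rfl)
    (fun t ht z hz => by
      rw [hφb t ht z hz, w4 t ht z hz]; linarith [(abs_le.1 (huM t ht z hz)).1]) t ht
  have := Xnorm_le_add (x := φ x₀ u t) hGopen hGbdd p hp y5 w5 (fun z hz => by
    have := hup z hz
    have := hlo z hz
    refine abs_le.2 ⟨?_, ?_⟩
    · linarith [neg_abs_le (w t z), abs_nonneg (y t z)]
    · linarith [le_abs_self (y t z), abs_nonneg (w t z)])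
  linarith

end
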